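/- For any nonzero rational number m and positive integer n, ∑_{k=0}^{n−1} C(2k, k+1)/m^k = C(2n−1, n−1)/m^{n−1} − m/2 + ((m−2)/2)·∑_{k=0}^{n−1} C(2k, k)/m^k. -/

import Mathlib

theorem choose_two_mul_add_one_left (n : ℕ) :
    (2 * n + 1).choose n = (2 * n).choose n + (2 * n).choose (n + 1) := by
  rw [← Nat.choose_symm_half, Nat.choose_succ_succ']

theorem choose_two_mul_succ_eq_two_mul (n : ℕ) :
    (2 * (n + 1)).choose (n + 1) = 2 * (2 * n + 1).choose n := by
  rw [show 2 * (n + 1) = 2 * n + 1 + 1 by ring, Nat.choose_succ_succ', Nat.choose_symm_half]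
  ring

theorem sum_central_binom_div (m : ℚ) (hm : m ≠ 0) (n : ℕ) (hn : 0 < n) :
    ∑ k ∈ Finset.range n, (Nat.choose (2 * k) (k + 1) : ℚ) / m ^ k
      = (Nat.choose (2 * n - 1) (n - 1) : ℚ) / m ^ (n - 1) - m / 2
        + (m - 2) / 2 * ∑ k ∈ Finset.range n, (Nat.choose (2 * k) k : ℚ) / m ^ k := by
  induction n, hn using Nat.le_induction with
  | base => norm_num; ring
  | succ n hn ih =>
    obtain ⟨N, rfl⟩ : ∃ N, n = N + 1 := ⟨n - 1, by omega⟩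
    rw [Finset.sum_range_succ, ih, Finset.sum_range_succ _ (N + 1),
      show 2 * (N + 1 + 1) - 1 = 2 * (N + 1) + 1 by omega,
      show 2 * (N + 1) - 1 = 2 * N + 1 by omega, Nat.add_sub_cancel, Nat.add_sub_cancel,
      choose_two_mul_add_one_left (N + 1), choose_two_mul_succ_eq_two_mul N]
    push_cast
    field_simp
    ring
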